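/- Let H > 0 be a real number, ζ the Riemann zeta function, γ_E the Euler–Mascheroni constant, and E₂(s) = Π_p ( 1 + p^{−s}/(p²(p−1)) − p^{−2s}/(p³(p−1)) ) (product over primes, convergent for Re(s) > −3/2). The function g(s) = (s+1) ζ(s+1) ζ(s+2) E₂(s) H^{s+2} / ( s(s+2) ), a priori defined and holomorphic on a punctured neighbourhood of s = −1, extends holomorphically to s = −1, with g(−1) = −ζ(0) H and g'(−1) = −ζ(0) H log H + Γ₋₁ H, where Γ₋₁ = ζ(0)( −γ_E − Σ_p (log p)/(p(p−1)) ) − ζ'(0). Equivalently, the residue at s = −1 of ζ(s+1)ζ(s+2)E₂(s)H^{s+2}/(s(s+1)(s+2)) equals −ζ(0) H log H + Γ₋₁ H. -/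

import Mathlib

open scoped Topology

/-- The Euler factor `1 + p^{−s}/(p²(p−1)) − p^{−2s}/(p³(p−1))`. -/
noncomputable def eulerFactor (s : ℂ) (p : Nat.Primes) : ℂ :=
  1 + ((p : ℕ) : ℂ) ^ (-s) / (((p : ℕ) : ℂ) ^ 2 * (((p : ℕ) : ℂ) - 1))
    - ((p : ℕ) : ℂ) ^ (-(2 * s)) / (((p : ℕ) : ℂ) ^ 3 * (((p : ℕ) : ℂ) - 1))

/-- `E₂(s) = Π_p (1 + p^{−s}/(p²(p−1)) − p^{−2s}/(p³(p−1)))`. -/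
noncomputable def E₂ (s : ℂ) : ℂ := ∏' p : Nat.Primes, eulerFactor s p

/-- `Γ₋₁ = ζ(0)(−γ_E − Σ_p (log p)/(p(p−1))) − ζ'(0)`, as a complex number. -/
noncomputable def GammaMinusOneC : ℂ :=
  riemannZeta 0 * (-(Real.eulerMascheroniConstant : ℂ) -
      ((∑' p : Nat.Primes, Real.log p / ((p : ℝ) * ((p : ℝ) - 1))) : ℝ)) -
    deriv riemannZeta 0

/-- On `Re s > -5/4` the Euler factors differ from `1` by at most `4 p^{-3/2}`. -/
lemma norm_eulerFactor_sub_one_le (p : Nat.Primes) {s : ℂ} (hs : -5 / 4 < s.re) :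
    ‖eulerFactor s p - 1‖ ≤ 4 * (p : ℝ) ^ (-(3 / 2) : ℝ) := by
  have hp2 : (2 : ℝ) ≤ (p : ℕ) := by exact_mod_cast p.2.two_le
  have hp0 : (0 : ℝ) < (p : ℕ) := by linarith
  have hsub : ‖((p : ℕ) : ℂ) - 1‖ = (p : ℝ) - 1 := by
    rw [← Complex.ofReal_natCast, ← Complex.ofReal_one, ← Complex.ofReal_sub,
      Complex.norm_real, Real.norm_of_nonneg (by linarith)]
  have key : ∀ (z : ℂ) (n : ℕ), z.re - n - 1 ≤ -(3 / 2) →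
      ‖((p : ℕ) : ℂ) ^ z / (((p : ℕ) : ℂ) ^ n * (((p : ℕ) : ℂ) - 1))‖
        ≤ 2 * (p : ℝ) ^ (-(3 / 2) : ℝ) := by
    intro z n hz
    rw [norm_div, norm_mul, norm_pow, hsub, Complex.norm_natCast_cpow_of_pos p.2.pos,
      Complex.norm_natCast]
    have h1 : (p : ℝ) ^ n * (p / 2) ≤ (p : ℝ) ^ n * (p - 1) := by
      gcongr
      linarith
    calc (p : ℝ) ^ z.re / ((p : ℝ) ^ n * (p - 1))
        ≤ (p : ℝ) ^ z.re / ((p : ℝ) ^ n * (p / 2)) := by gcongr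
      _ = 2 * (p : ℝ) ^ (z.re - n - 1) := by
          rw [Real.rpow_sub hp0, Real.rpow_sub hp0, Real.rpow_natCast, Real.rpow_one]
          field_simp
      _ ≤ _ := by gcongr; linarith
  have h1 := key (-s) 2 (by simp; linarith)
  have h2 := key (-(2 * s)) 3 (by simp; linarith)
  have h3 : eulerFactor s p - 1 =
      ((p : ℕ) : ℂ) ^ (-s) / (((p : ℕ) : ℂ) ^ 2 * (((p : ℕ) : ℂ) - 1))
        - ((p : ℕ) : ℂ) ^ (-(2 * s)) / (((p : ℕ) : ℂ) ^ 3 * (((p : ℕ) : ℂ) - 1)) := by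
    unfold eulerFactor
    ring
  rw [h3]
  linarith [norm_sub_le
    (((p : ℕ) : ℂ) ^ (-s) / (((p : ℕ) : ℂ) ^ 2 * (((p : ℕ) : ℂ) - 1)))
    (((p : ℕ) : ℂ) ^ (-(2 * s)) / (((p : ℕ) : ℂ) ^ 3 * (((p : ℕ) : ℂ) - 1)))]

@[fun_prop]
lemma differentiable_eulerFactor (p : Nat.Primes) :
    Differentiable ℂ fun s ↦ eulerFactor s p := by
  have hp : ((p : ℕ) : ℂ) ≠ 0 := by exact_mod_cast p.2.ne_zero
  unfold eulerFactor
  simp only [Complex.cpow_def_of_ne_zero hp]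
  fun_prop

lemma eulerFactor_neg_one (p : Nat.Primes) : eulerFactor (-1) p = 1 := by
  have hp : ((p : ℕ) : ℂ) ≠ 0 := by exact_mod_cast p.2.ne_zero
  have h2 : ((p : ℕ) : ℂ) ^ (-(2 * (-1)) : ℂ) = ((p : ℕ) : ℂ) ^ 2 := by
    rw [← Complex.cpow_natCast]
    norm_num
  have hp' : ((p : ℕ) : ℂ) - 1 ≠ 0 := sub_ne_zero.2 (by exact_mod_cast p.2.one_lt.ne')
  rw [eulerFactor, h2, neg_neg, Complex.cpow_one]
  field_simp
  ring

lemma deriv_eulerFactor_neg_one (p : Nat.Primes) :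
    deriv (fun s ↦ eulerFactor s p) (-1) =
      ((Real.log p / ((p : ℝ) * ((p : ℝ) - 1)) : ℝ) : ℂ) := by
  have hp : ((p : ℕ) : ℂ) ≠ 0 := by exact_mod_cast p.2.ne_zero
  have hp' : ((p : ℕ) : ℂ) - 1 ≠ 0 := sub_ne_zero.2 (by exact_mod_cast p.2.one_lt.ne')
  have h2 : ((p : ℕ) : ℂ) ^ (-(2 * (-1)) : ℂ) = ((p : ℕ) : ℂ) ^ 2 := by
    rw [← Complex.cpow_natCast]
    norm_num
  have d1 := ((hasDerivAt_id (-1 : ℂ)).neg.const_cpow (c := ((p : ℕ) : ℂ)) (Or.inl hp)).div_const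
    (((p : ℕ) : ℂ) ^ 2 * (((p : ℕ) : ℂ) - 1))
  have d2 := (((hasDerivAt_id (-1 : ℂ)).const_mul 2).neg.const_cpow
    (c := ((p : ℕ) : ℂ)) (Or.inl hp)).div_const (((p : ℕ) : ℂ) ^ 3 * (((p : ℕ) : ℂ) - 1))
  have d := ((d1.const_add 1).sub d2).deriv
  refine Eq.trans d ?_
  simp only [id, Pi.neg_apply, h2, neg_neg, Complex.cpow_one]
  push_cast
  rw [← Complex.natCast_log]
  field_simp
  ring

lemma summable_log_div_mul_sub_one :
    Summable fun p : Nat.Primes ↦ Real.log p / ((p : ℝ) * ((p : ℝ) - 1)) := by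
  refine ((Nat.Primes.summable_rpow.2 (by norm_num : (-(3 / 2) : ℝ) < -1)).mul_left
    4).of_nonneg_of_le (fun p ↦ ?_) fun p ↦ ?_
  all_goals
    have hp2 : (2 : ℝ) ≤ (p : ℕ) := by exact_mod_cast p.2.two_le
    have hp0 : (0 : ℝ) < (p : ℕ) := by linarith
  · exact div_nonneg (Real.log_nonneg (by linarith)) (mul_nonneg hp0.le (by linarith))
  · have hlog := Real.log_le_rpow_div hp0.le (by norm_num : (0 : ℝ) < 1 / 2)
    calc Real.log p / ((p : ℝ) * ((p : ℝ) - 1))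
        ≤ ((p : ℝ) ^ (1 / 2 : ℝ) / (1 / 2)) / ((p : ℝ) * (p / 2)) := by
          gcongr
          linarith
      _ = 4 * (p : ℝ) ^ ((1 / 2 : ℝ) - 1 - 1) := by
          rw [Real.rpow_sub hp0, Real.rpow_sub hp0, Real.rpow_one]
          field_simp
          norm_num
      _ = _ := by norm_num

lemma isOpen_halfPlane_neg_five_fourths : IsOpen {s : ℂ | -5 / 4 < s.re} :=
  isOpen_lt continuous_const Complex.continuous_re

lemma multipliableLocallyUniformlyOn_eulerFactor :
    MultipliableLocallyUniformlyOn (fun (p : Nat.Primes) s ↦ eulerFactor s p)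
      {s : ℂ | -5 / 4 < s.re} := by
  have := Summable.multipliableLocallyUniformlyOn_one_add
    (f := fun (p : Nat.Primes) s ↦ eulerFactor s p - 1) isOpen_halfPlane_neg_five_fourths
    ((Nat.Primes.summable_rpow.2 (by norm_num : (-(3 / 2) : ℝ) < -1)).mul_left 4)
    (.of_forall fun p s hs ↦ norm_eulerFactor_sub_one_le p hs)
    fun p ↦ ((differentiable_eulerFactor p).sub_const 1).continuous.continuousOn
  simpa only [add_sub_cancel] using this

lemma differentiableOn_E₂ : DifferentiableOn ℂ E₂ {s : ℂ | -5 / 4 < s.re} :=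
  multipliableLocallyUniformlyOn_eulerFactor.hasProdLocallyUniformlyOn.differentiableOn
    (.of_forall fun t ↦ by fun_prop)
    isOpen_halfPlane_neg_five_fourths

lemma E₂_neg_one : E₂ (-1) = 1 := by
  simp [E₂, eulerFactor_neg_one]

lemma deriv_E₂_neg_one :
    deriv E₂ (-1) =
      ((∑' p : Nat.Primes, Real.log p / ((p : ℝ) * ((p : ℝ) - 1)) : ℝ) : ℂ) := by
  have hlog : ∀ p : Nat.Primes, logDeriv (fun s ↦ eulerFactor s p) (-1) =
      ((Real.log p / ((p : ℝ) * ((p : ℝ) - 1)) : ℝ) : ℂ) := fun p ↦ by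
    rw [logDeriv_apply, deriv_eulerFactor_neg_one, eulerFactor_neg_one, div_one]
  have h := logDeriv_tprod_eq_tsum isOpen_halfPlane_neg_five_fourths (x := -1)
    (by simp; norm_num) (f := fun (p : Nat.Primes) s ↦ eulerFactor s p)
    (fun p ↦ by simp [eulerFactor_neg_one])
    (fun p ↦ (differentiable_eulerFactor p).differentiableOn)
    (by simpa only [hlog] using Complex.summable_ofReal.2 summable_log_div_mul_sub_one)
    multipliableLocallyUniformlyOn_eulerFactor (by simp [eulerFactor_neg_one])
  simp only [hlog] at h
  rw [Complex.ofReal_tsum, ← h]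
  change _ = logDeriv E₂ (-1)
  rw [logDeriv_apply, E₂_neg_one, div_one]

theorem statement15 (H : ℝ) (hH : 0 < H) :
    ∃ g : ℂ → ℂ,
      AnalyticAt ℂ g (-1) ∧
      (∀ᶠ s in 𝓝[≠] (-1 : ℂ), g s =
        (s + 1) * riemannZeta (s + 1) * riemannZeta (s + 2) * E₂ s
          * Complex.exp ((s + 2) * (Real.log H : ℂ)) / (s * (s + 2))) ∧
      g (-1) = -riemannZeta 0 * (H : ℂ) ∧
      deriv g (-1)
        = -riemannZeta 0 * (H : ℂ) * (Real.log H : ℂ) + GammaMinusOneC * (H : ℂ) := by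
  have hU : {s : ℂ | -5 / 4 < s.re} ∈ 𝓝 (-1 : ℂ) :=
    isOpen_halfPlane_neg_five_fourths.mem_nhds (by simp; norm_num)
  have hE : AnalyticAt ℂ E₂ (-1) := differentiableOn_E₂.analyticAt hU
  have hZ : AnalyticAt ℂ (fun s : ℂ ↦ riemannZeta (s + 1)) (-1) := by
    have hd : DifferentiableOn ℂ (fun s : ℂ ↦ riemannZeta (s + 1)) {0}ᶜ := fun s hs ↦
      (differentiableAt_comp_add_const.2
        (differentiableAt_riemannZeta (by simpa using hs))).differentiableWithinAt
    exact hd.analyticAt (isOpen_compl_singleton.mem_nhds (by simp))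
  have hZ₁ : AnalyticAt ℂ (fun s : ℂ ↦ riemannZeta₁ (s + 2)) (-1) :=
    Differentiable.analyticAt (by fun_prop) _
  have hX : AnalyticAt ℂ (fun s : ℂ ↦ Complex.exp ((s + 2) * (Real.log H : ℂ))) (-1) :=
    Differentiable.analyticAt (by fun_prop) _
  have hQ : AnalyticAt ℂ (fun s : ℂ ↦ s * (s + 2)) (-1) :=
    Differentiable.analyticAt (by fun_prop) _
  have hexp : Complex.exp (Real.log H : ℂ) = H := by
    rw [← Complex.ofReal_exp, Real.exp_log hH]
  have h12 : (-1 + 2 : ℂ) = 1 := by norm_num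
  refine ⟨fun s ↦ riemannZeta₁ (s + 2) * riemannZeta (s + 1) * E₂ s
    * Complex.exp ((s + 2) * (Real.log H : ℂ)) / (s * (s + 2)),
    (((hZ₁.mul hZ).mul hE).mul hX).div hQ (by norm_num), ?_, ?_, ?_⟩
  · filter_upwards [self_mem_nhdsWithin] with s hs
    have hs1 : s + 1 ≠ 0 := fun h ↦ hs (eq_neg_of_add_eq_zero_left h)
    have hs2 : s + 2 ≠ 1 := fun h ↦ hs1 (by linear_combination h)
    rw [riemannZeta_eq_inv_sub_mul hs2, show s + 2 - 1 = s + 1 by ring]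
    field_simp
  · simp only [h12, riemannZeta₁_one, neg_add_cancel, E₂_neg_one, one_mul, mul_one, hexp]
    ring
  · have dZ : HasDerivAt (fun s : ℂ ↦ riemannZeta (s + 1)) (deriv riemannZeta 0) (-1) := by
      simpa [deriv_comp_add_const] using hZ.differentiableAt.hasDerivAt
    have dZ₁ : HasDerivAt (fun s : ℂ ↦ riemannZeta₁ (s + 2))
        (Real.eulerMascheroniConstant : ℂ) (-1) := by
      simpa [deriv_comp_add_const, h12] using hZ₁.differentiableAt.hasDerivAt
    have dE := hE.differentiableAt.hasDerivAt
    rw [deriv_E₂_neg_one] at dE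
    have dX := (((hasDerivAt_id (-1 : ℂ)).add_const 2).mul_const (Real.log H : ℂ)).cexp
    have dQ := (hasDerivAt_id (-1 : ℂ)).mul ((hasDerivAt_id (-1 : ℂ)).add_const 2)
    have d := ((((dZ₁.mul dZ).mul dE).mul dX).div dQ (by norm_num)).deriv
    refine Eq.trans d ?_
    simp only [id, Pi.mul_apply, h12, riemannZeta₁_one, neg_add_cancel, E₂_neg_one, one_mul,
      mul_one, hexp, GammaMinusOneC]
    ring
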